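/- Let K be a field of characteristic zero and consider F = K(x) and the two commuting automorphisms σ_x, σ_y of F[y] given by x ↦ x+1 and y ↦ y+1. If p ∈ K[x,y] is irreducible and there exist integers m, n, not both zero, with σ_x^m σ_y^n(p) an associate of p, then p(x,y) = P(λx + μy) for some univariate polynomial P ∈ K[z] and integers λ, μ not both zero. -/

import Mathlib

open MvPolynomial

theorem zpow_shift_aux {R : Type*} [CommRing R] (σ : RingAut R) (a d : R)
    (h : σ a = a + d) (hd : σ d = d) (m : ℤ) : (σ ^ m) a = a + (m : R) * d := by
  have hinv : (σ⁻¹) a = a - d := by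
    apply σ.injective
    have : σ (σ⁻¹ a) = a := σ.apply_symm_apply a
    rw [this, map_sub, h, hd]; ring
  have hdinv : (σ⁻¹) d = d := by
    apply σ.injective
    have : σ (σ⁻¹ d) = d := σ.apply_symm_apply d
    rw [this, hd]
  induction m using Int.induction_on with
  | zero => simp
  | succ k ih =>
    rw [add_comm (k : ℤ) 1, zpow_add, zpow_one, RingAut.mul_apply, ih, map_add, map_mul, map_intCast, h, hd]
    push_cast; ring
  | pred k ih =>
    rw [sub_eq_add_neg, add_comm, zpow_add, zpow_neg_one, RingAut.mul_apply, ih, map_add, map_mul,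
      map_intCast, hinv, hdinv]
    push_cast; ring

theorem taylor_aux {A : Type*} [CommRing A] [IsDomain A] [CharZero A] (q : Polynomial A) (c : A)
    (h : Polynomial.taylor 1 q = Polynomial.C c * q) : q = Polynomial.C (q.eval 0) := by
  by_cases hq : q = 0
  · simp [hq]
  have hc : c = 1 := by
    have h1 := congrArg (fun r => Polynomial.coeff r q.natDegree) h
    simp only [Polynomial.coeff_C_mul] at h1
    have h2 : (Polynomial.taylor 1 q).coeff q.natDegree = q.leadingCoeff := by
      simp
    rw [h2, Polynomial.coeff_natDegree] at h1
    have h3 : q.leadingCoeff ≠ 0 := Polynomial.leadingCoeff_ne_zero.mpr hq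
    exact (mul_right_cancel₀ h3 (by rw [one_mul]; exact h1)).symm
  subst hc
  rw [map_one, one_mul] at h
  have hk : ∀ k : ℕ, q.eval (k : A) = q.eval 0 := by
    intro k
    induction k with
    | zero => simp
    | succ k ih =>
      rw [← ih]
      conv_rhs => rw [← h, Polynomial.taylor_eval]
      push_cast; rfl
  apply Polynomial.eq_of_infinite_eval_eq
  apply Set.Infinite.mono (s := Set.range (fun k : ℕ => (k : A)))
  · rintro _ ⟨k, rfl⟩
    simp [hk]
  · exact Set.infinite_range_of_injective Nat.cast_injective

/-- In the usual shift case, an irreducible polynomial `p ∈ K[x,y]` with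
`σ_x^m σ_y^n(p)` an associate of `p` for some `(m,n) ≠ (0,0)` has the form
`P(λx + μy)` with `λ, μ` integers, not both zero. -/
theorem integer_linear_shift (K : Type*) [Field K] [CharZero K]
    (σx σy : RingAut (MvPolynomial (Fin 2) K))
    (hxX : σx (X 0) = X 0 + 1) (hxY : σx (X 1) = X 1)
    (hxC : ∀ c : K, σx (C c) = C c)
    (hyX : σy (X 0) = X 0) (hyY : σy (X 1) = X 1 + 1)
    (hyC : ∀ c : K, σy (C c) = C c)
    (p : MvPolynomial (Fin 2) K) (hirr : Irreducible p)
    (hassoc : ∃ m n : ℤ, ¬(m = 0 ∧ n = 0) ∧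
      ∃ c : K, c ≠ 0 ∧ (σx ^ m) ((σy ^ n) p) = C c * p) :
    ∃ (P : Polynomial K) (lam mu : ℤ), ¬(lam = 0 ∧ mu = 0) ∧
      p = Polynomial.aeval (lam • X 0 + mu • X 1) P := by
  obtain ⟨m, n, hmn, c, hc, h⟩ := hassoc
  obtain ⟨a, b, hab⟩ : ∃ a b : K, (n : K) * a - m * b = 1 := by
    by_cases hm : m = 0
    · have hn : (n : K) ≠ 0 := by
        intro h0; exact hmn ⟨hm, by exact_mod_cast h0⟩
      exact ⟨(n : K)⁻¹, 0, by simp [hn]⟩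
    · have hm : (m : K) ≠ 0 := by exact_mod_cast hm
      exact ⟨0, -(m : K)⁻¹, by simp [hm]⟩
  let κ : K →+* Polynomial (Polynomial K) := Polynomial.C.comp Polynomial.C
  let φ : MvPolynomial (Fin 2) K →+* Polynomial (Polynomial K) :=
    eval₂Hom κ
      ![(m : Polynomial (Polynomial K)) * Polynomial.X + κ a * Polynomial.C Polynomial.X,
        (n : Polynomial (Polynomial K)) * Polynomial.X + κ b * Polynomial.C Polynomial.X]
  let z : MvPolynomial (Fin 2) K := n • X 0 + (-m) • X 1
  let ψ : Polynomial (Polynomial K) →+* MvPolynomial (Fin 2) K :=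
    Polynomial.eval₂RingHom (Polynomial.aeval z : Polynomial K →ₐ[K] _).toRingHom
      (-C b * X 0 + C a * X 1)
  have hφ0 : φ (X 0) = (m : Polynomial (Polynomial K)) * Polynomial.X
      + κ a * Polynomial.C Polynomial.X := by simp [φ]
  have hφ1 : φ (X 1) = (n : Polynomial (Polynomial K)) * Polynomial.X
      + κ b * Polynomial.C Polynomial.X := by simp [φ]
  have hφC : ∀ r, φ (C r) = κ r := by intro r; simp [φ]
  have hψX : ψ Polynomial.X = -C b * X 0 + C a * X 1 := by simp [ψ]
  have hψC : ∀ r, ψ (Polynomial.C r) = Polynomial.aeval z r := by intro r; simp [ψ]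
  have hψκ : ∀ r, ψ (κ r) = C r := by
    intro r
    change ψ (Polynomial.C (Polynomial.C r)) = _
    rw [hψC, Polynomial.aeval_C]; rfl
  have hab' : (n : MvPolynomial (Fin 2) K) * C a - (m : MvPolynomial (Fin 2) K) * C b = 1 := by
    have := congrArg (C : K →+* MvPolynomial (Fin 2) K) hab
    simpa using this
  have hz : z = (n : MvPolynomial (Fin 2) K) * X 0 - (m : MvPolynomial (Fin 2) K) * X 1 := by
    simp only [z, zsmul_eq_mul]; push_cast; ring
  have hψφ : ψ.comp φ = RingHom.id _ := by
    apply MvPolynomial.ringHom_ext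
    · intro r; simp [hφC, hψκ]
    · intro i
      fin_cases i
      · simp only [RingHom.comp_apply, RingHom.id_apply, Fin.zero_eta, hφ0, map_add, map_mul,
          map_intCast, hψX, hψκ, hψC, Polynomial.aeval_X, hz]
        linear_combination (X 0) * hab'
      · simp only [RingHom.comp_apply, RingHom.id_apply, Fin.mk_one, hφ1, map_add, map_mul,
          map_intCast, hψX, hψκ, hψC, Polynomial.aeval_X, hz]
        linear_combination (X 1) * hab'
  have hx0 := zpow_shift_aux σx (X 0) 1 hxX (map_one _) m
  have hx1 := zpow_shift_aux σx (X 1) 0 (by simpa using hxY) (map_zero _) m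
  have hxc := fun r => zpow_shift_aux σx (C r) 0 (by simpa using hxC r) (map_zero _) m
  have hy1 := zpow_shift_aux σy (X 1) 1 hyY (map_one _) n
  have hy0 := zpow_shift_aux σy (X 0) 0 (by simpa using hyX) (map_zero _) n
  have hyc := fun r => zpow_shift_aux σy (C r) 0 (by simpa using hyC r) (map_zero _) n
  simp only [mul_one, mul_zero, add_zero] at hx0 hx1 hxc hy0 hy1 hyc
  let τ : Polynomial (Polynomial K) →+* Polynomial (Polynomial K) :=
    (Polynomial.taylorAlgHom (1 : Polynomial K)).toRingHom
  have hτX : τ Polynomial.X = Polynomial.X + 1 := by simp [τ]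
  have hτC : ∀ r, τ (Polynomial.C r) = Polynomial.C r := by intro r; simp [τ]
  have hτκ : ∀ r, τ (κ r) = κ r := fun r => hτC _
  have hcomm : (φ.comp ((σx ^ m : RingAut _) : MvPolynomial (Fin 2) K →+* _)).comp
      ((σy ^ n : RingAut _) : MvPolynomial (Fin 2) K →+* _) = τ.comp φ := by
    apply MvPolynomial.ringHom_ext
    · intro r
      simp only [RingHom.comp_apply, RingHom.coe_coe, hyc, hxc, hφC, hτκ]
    · intro i
      fin_cases i
      · simp only [RingHom.comp_apply, RingHom.coe_coe, Fin.zero_eta, hy0, hx0, hφ0, map_add,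
          map_mul, map_intCast, hτX, hτκ, hτC]
        ring
      · simp only [RingHom.comp_apply, RingHom.coe_coe, Fin.mk_one, hy1, hx1, hφ1, map_add,
          map_mul, map_intCast, hτX, hτκ, hτC]
        ring
  have hq : Polynomial.taylor 1 (φ p) = Polynomial.C (Polynomial.C c) * φ p := by
    have h1 := RingHom.congr_fun hcomm p
    simp only [RingHom.comp_apply, RingHom.coe_coe, h, map_mul, hφC] at h1
    exact h1.symm
  have h2 := taylor_aux _ _ hq
  refine ⟨(φ p).eval 0, n, -m, ?_, ?_⟩
  · rintro ⟨h3, h4⟩; exact hmn ⟨by omega, h3⟩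
  · have h3 := RingHom.congr_fun hψφ p
    rw [RingHom.comp_apply, h2, hψC] at h3
    exact h3.symm
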